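/- For the 5-state 2-symbol Turing machine M with transition table δ(A,0)=(1,R,B), δ(A,1)=(1,L,C), δ(B,0)=(1,R,C), δ(B,1)=(1,R,B), δ(C,0)=(1,R,D), δ(C,1)=(0,L,E), δ(D,0)=(1,L,A), δ(D,1)=(1,L,D), δ(E,0)=(1,R,H), δ(E,1)=(0,L,A), and for every natural number k: from any configuration C(3k) the machine reaches a configuration C(5k+6) in exactly 5k²+19k+15 steps; from any configuration C(3k+1) it reaches a configuration C(5k+9) in exactly 5k²+25k+27 steps; and from any configuration C(3k+2) it halts in exactly 6k+12 steps, the final tape reading left to right (all other cells blank): 1, the halted head scanning a cell containing 0, then 1, then k+1 consecutive blocks 0,0,1, then 1. -/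

import Mathlib

/-- Move direction of the tape head. -/
inductive Dir : Type
  | L
  | R

/-- The head displacement of a direction. -/
def Dir.move : Dir → ℤ
  | Dir.L => -1
  | Dir.R => 1

/-- A Turing machine with `n` states and `k` symbols, in Rado's busy beaver model.
States are `Fin n` (state `A` is `0`, `B` is `1`, ...), symbols are `Fin k` with `0`
the blank symbol. A transition yields the written symbol, the move direction and the
next state, where `none` denotes the halting state `H`. -/
abbrev Machine (n k : ℕ) : Type :=
  Fin n → Fin k → Fin k × Dir × Option (Fin n)

/-- A configuration: current state (`none` = halted), head position, tape. -/
structure Cfg (n k : ℕ) where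
  state : Option (Fin n)
  pos : ℤ
  tape : ℤ → Fin k

/-- One computation step (halted configurations are fixed). -/
def step {n k : ℕ} (M : Machine n k) (c : Cfg n k) : Cfg n k :=
  match c.state with
  | none => c
  | some q =>
      { state := (M q (c.tape c.pos)).2.2
        pos := c.pos + (M q (c.tape c.pos)).2.1.move
        tape := Function.update c.tape c.pos (M q (c.tape c.pos)).1 }

/-- The initial configuration: state `A`, head at cell `0`, all-blank tape. -/
def init (n k : ℕ) [NeZero k] : Cfg n k :=
  { state := if h : 0 < n then some ⟨0, h⟩ else none
    pos := 0
    tape := fun _ => 0 }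

/-- `HaltsIn M c t`: started from `c`, the machine `M` halts after exactly `t` steps. -/
def HaltsIn {n k : ℕ} (M : Machine n k) (c : Cfg n k) (t : ℕ) : Prop :=
  ((step M)^[t] c).state = none ∧ ∀ i < t, ((step M)^[i] c).state ≠ none

/-- The number of non-blank cells of a configuration. -/
noncomputable def sigmaCount {n k : ℕ} [NeZero k] (c : Cfg n k) : ℕ :=
  Set.ncard {i : ℤ | c.tape i ≠ 0}

/-- Marxen and Buntrock's 5-state 2-symbol champion machine
(states `A,B,C,D,E` are `0,1,2,3,4`; `none` is the halting state `H`). -/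
def M : Machine 5 2 :=
  ![![(1, Dir.R, some 1), (1, Dir.L, some 2)],
    ![(1, Dir.R, some 2), (1, Dir.R, some 1)],
    ![(1, Dir.R, some 3), (0, Dir.L, some 4)],
    ![(1, Dir.L, some 0), (1, Dir.L, some 3)],
    ![(1, Dir.R, none), (0, Dir.L, some 0)]]

/-- The configuration `C(n)` with head at cell `p`: state `A`, scanned cell blank,
the `n` cells immediately to the right of the head all contain `1`, all other cells blank. -/
def Cf (n : ℕ) (p : ℤ) : Cfg 5 2 :=
  { state := some 0
    pos := p
    tape := fun i => if p < i ∧ i ≤ p + n then 1 else 0 }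

/-- Prepend a symbol to a half-tape. -/
def consTape (a : Fin 2) (s : ℕ → Fin 2) : ℕ → Fin 2
  | 0 => a
  | n + 1 => s n

/-- The blank half-tape. -/
def blankTape : ℕ → Fin 2 := fun _ => 0

/-- The block `1^n` followed by `s`. -/
def onesTape (n : ℕ) (s : ℕ → Fin 2) : ℕ → Fin 2 := (consTape 1)^[n] s

/-- The block `(001)^n` followed by `s`. -/
def blockTape (n : ℕ) (s : ℕ → Fin 2) : ℕ → Fin 2 :=
  (fun s => consTape 0 (consTape 0 (consTape 1 s)))^[n] s

/-- The configuration with head at `p`, where `l` lists the cells to the left of the head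
(nearest first) and `r` lists the scanned cell and the cells to its right. -/
def zipCfg (q : Option (Fin 5)) (p : ℤ) (l r : ℕ → Fin 2) : Cfg 5 2 :=
  { state := q
    pos := p
    tape := fun i => if i < p then l (p - 1 - i).toNat else r (i - p).toNat }

/-- `Reaches t q l r q' l' r'`: in `t` steps `M` passes from the first zipper configuration
to the second, up to the head position. -/
def Reaches (t : ℕ) (q : Option (Fin 5)) (l r : ℕ → Fin 2)
    (q' : Option (Fin 5)) (l' r' : ℕ → Fin 2) : Prop :=
  ∀ p : ℤ, ∃ p' : ℤ, (step M)^[t] (zipCfg q p l r) = zipCfg q' p' l' r'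

theorem consTape_blankTape : consTape 0 blankTape = blankTape := by
  funext n
  cases n <;> rfl

theorem onesTape_succ (n : ℕ) (s : ℕ → Fin 2) :
    onesTape (n + 1) s = consTape 1 (onesTape n s) :=
  Function.iterate_succ_apply' _ _ _

theorem onesTape_consTape (n : ℕ) (s : ℕ → Fin 2) :
    onesTape n (consTape 1 s) = consTape 1 (onesTape n s) := by
  rw [← onesTape_succ]
  exact (Function.iterate_succ_apply _ _ _).symm

theorem blockTape_succ (n : ℕ) (s : ℕ → Fin 2) :
    blockTape (n + 1) s = consTape 0 (consTape 0 (consTape 1 (blockTape n s))) :=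
  Function.iterate_succ_apply' _ _ _

theorem consTape_toNat (a : Fin 2) (s : ℕ → Fin 2) (z : ℤ) (hz : 0 < z) :
    consTape a s z.toNat = s (z - 1).toNat := by
  obtain ⟨m, rfl⟩ : ∃ m : ℕ, z = m + 1 := ⟨(z - 1).toNat, by omega⟩
  have h : ((m : ℤ) + 1).toNat = m + 1 := by omega
  rw [h]
  simp [consTape]

theorem step_zipCfg_right {q : Fin 5} {a w : Fin 2} {q' : Option (Fin 5)}
    (h : M q a = (w, Dir.R, q')) (p : ℤ) (l r : ℕ → Fin 2) :
    step M (zipCfg (some q) p l (consTape a r)) = zipCfg q' (p + 1) (consTape w l) r := by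
  have ha : (if p < p then l (p - 1 - p).toNat else consTape a r (p - p).toNat) = a := by
    simp [consTape]
  simp only [step, zipCfg, ha, h, Dir.move, Cfg.mk.injEq, true_and]
  funext i
  rcases lt_trichotomy i p with hi | rfl | hi
  · rw [Function.update_of_ne hi.ne, if_pos hi, if_pos (by omega), consTape_toNat _ _ _ (by omega)]
    congr 2
    omega
  · simp [consTape]
  · rw [Function.update_of_ne hi.ne', if_neg (by omega), if_neg (by omega),
      consTape_toNat _ _ _ (by omega)]
    congr 2
    omega

theorem step_zipCfg_left {q : Fin 5} {a w : Fin 2} {q' : Option (Fin 5)}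
    (h : M q a = (w, Dir.L, q')) (p : ℤ) (b : Fin 2) (l r : ℕ → Fin 2) :
    step M (zipCfg (some q) p (consTape b l) (consTape a r)) =
      zipCfg q' (p - 1) l (consTape b (consTape w r)) := by
  have ha : (if p < p then consTape b l (p - 1 - p).toNat else consTape a r (p - p).toNat) = a := by
    simp [consTape]
  simp only [step, zipCfg, ha, h, Dir.move, Cfg.mk.injEq, true_and]
  refine ⟨by ring, ?_⟩
  funext i
  rcases lt_trichotomy i p with hi | rfl | hi
  · rw [Function.update_of_ne hi.ne, if_pos hi]
    rcases eq_or_lt_of_le (show i ≤ p - 1 by omega) with rfl | hi'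
    · simp [consTape]
    · rw [if_pos hi', consTape_toNat _ _ _ (by omega)]
      congr 2
      omega
  · simp [consTape]
  · rw [Function.update_of_ne hi.ne', if_neg (by omega), if_neg (by omega),
      consTape_toNat _ _ _ (by omega), consTape_toNat _ _ _ (by omega),
      consTape_toNat _ _ _ (by omega)]
    congr 2
    omega

namespace Reaches

variable {q q' q'' : Option (Fin 5)} {l r l' r' l'' r'' : ℕ → Fin 2}

theorem refl (q : Option (Fin 5)) (l r : ℕ → Fin 2) : Reaches 0 q l r q l r :=
  fun p => ⟨p, rfl⟩

theorem trans {s t : ℕ} (h : Reaches s q l r q' l' r') (h' : Reaches t q' l' r' q'' l'' r'') :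
    Reaches (s + t) q l r q'' l'' r'' := by
  intro p
  obtain ⟨p', hp'⟩ := h p
  obtain ⟨p'', hp''⟩ := h' p'
  exact ⟨p'', by rw [add_comm, Function.iterate_add_apply, hp', hp'']⟩

theorem right {t : ℕ} {a : Fin 5} {x w : Fin 2} (hM : M a x = (w, Dir.R, q'))
    (h : Reaches t q' (consTape w l) r q'' l'' r'') :
    Reaches (t + 1) (some a) l (consTape x r) q'' l'' r'' := by
  intro p
  obtain ⟨p', hp'⟩ := h (p + 1)
  exact ⟨p', by rw [Function.iterate_succ_apply, step_zipCfg_right hM, hp']⟩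

theorem left {t : ℕ} {a : Fin 5} {x w b : Fin 2} (hM : M a x = (w, Dir.L, q'))
    (h : Reaches t q' l (consTape b (consTape w r)) q'' l'' r'') :
    Reaches (t + 1) (some a) (consTape b l) (consTape x r) q'' l'' r'' := by
  intro p
  obtain ⟨p', hp'⟩ := h (p - 1)
  exact ⟨p', by rw [Function.iterate_succ_apply, step_zipCfg_left hM, hp']⟩

theorem left_blank {t : ℕ} {a : Fin 5} {x w : Fin 2} (hM : M a x = (w, Dir.L, q'))
    (h : Reaches t q' blankTape (consTape 0 (consTape w r)) q'' l'' r'') :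
    Reaches (t + 1) (some a) blankTape (consTape x r) q'' l'' r'' := by
  rw [← consTape_blankTape] at h ⊢
  rw [consTape_blankTape] at h
  exact left hM h

theorem right_blank {t : ℕ} {a : Fin 5} {w : Fin 2} (hM : M a 0 = (w, Dir.R, q'))
    (h : Reaches t q' (consTape w l) blankTape q'' l'' r'') :
    Reaches (t + 1) (some a) l blankTape q'' l'' r'' := by
  rw [← consTape_blankTape]
  exact right hM h

theorem sweep_right (n : ℕ) (l r : ℕ → Fin 2) :
    Reaches n (some 1) l (onesTape n r) (some 1) (onesTape n l) r := by
  induction n generalizing l with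
  | zero => exact refl _ _ _
  | succ n ih =>
    rw [onesTape_succ, onesTape_succ, ← onesTape_consTape n l]
    exact right (a := 1) (x := 1) rfl (ih _)

theorem sweep_left (n : ℕ) (l r : ℕ → Fin 2) :
    Reaches n (some 3) (onesTape n l) (consTape 1 r) (some 3) l (consTape 1 (onesTape n r)) := by
  induction n generalizing r with
  | zero => exact refl _ _ _
  | succ n ih =>
    rw [onesTape_succ, onesTape_succ, ← onesTape_consTape n r]
    exact left (a := 3) (x := 1) rfl (ih _)

/-- The first sweep over the block of ones. -/
theorem start (n : ℕ) :
    Reaches (n + 4) (some 0) blankTape (consTape 0 (onesTape n blankTape))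
      (some 0) (onesTape (n + 2) blankTape) (consTape 1 (consTape 1 blankTape)) := by
  have hturn (l : ℕ → Fin 2) : Reaches 1 (some 3) (consTape 1 l) blankTape
      (some 0) l (consTape 1 (consTape 1 blankTape)) := by
    have h := left (a := 3) (x := 0) (b := 1) (l := l) (r := blankTape) rfl (refl _ _ _)
    rwa [consTape_blankTape] at h
  have h : Reaches 3 (some 1) (onesTape n (consTape 1 blankTape)) blankTape
      (some 0) (onesTape (n + 2) blankTape) (consTape 1 (consTape 1 blankTape)) := by
    rw [onesTape_succ, onesTape_succ, onesTape_consTape]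
    exact right_blank rfl (right_blank rfl (hturn _))
  exact right (t := n + 3) rfl ((sweep_right n _ _).trans h)

/-- Going left, every three ones are replaced by a block `001`. -/
theorem make_blocks (n : ℕ) (l r : ℕ → Fin 2) :
    Reaches (3 * n) (some 0) (onesTape (3 * n) l) (consTape 1 r)
      (some 0) l (consTape 1 (blockTape n r)) := by
  induction n generalizing r with
  | zero => exact refl _ _ _
  | succ n ih =>
    have hround : Reaches 3 (some 0) (onesTape (3 * n + 3) l) (consTape 1 r)
        (some 0) (onesTape (3 * n) l)
        (consTape 1 (consTape 0 (consTape 0 (consTape 1 r)))) := by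
      rw [onesTape_succ, onesTape_succ, onesTape_succ]
      refine left rfl (left rfl (left rfl ?_))
      exact refl _ _ _
    have h := hround.trans (ih (consTape 0 (consTape 0 (consTape 1 r))))
    rw [add_comm] at h
    exact h

/-- One round trip absorbs one block `001` into the run of ones. -/
theorem absorb_block (m : ℕ) (r : ℕ → Fin 2) :
    Reaches (2 * m + 8) (some 0) blankTape
      (consTape 0 (onesTape m (consTape 0 (consTape 0 (consTape 1 r)))))
      (some 0) blankTape (consTape 0 (onesTape (m + 5) r)) := by
  have hback : Reaches (m + 3 + 2) (some 3) (onesTape (m + 3) blankTape) (consTape 1 r)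
      (some 0) blankTape (consTape 0 (onesTape (m + 5) r)) := by
    refine (sweep_left (m + 3) _ _).trans (left_blank rfl (left_blank rfl ?_))
    rw [onesTape_succ (m + 4), onesTape_succ (m + 3)]
    exact refl _ _ _
  have hturn : Reaches (m + 3 + 2 + 2) (some 1) (onesTape m (consTape 1 blankTape))
      (consTape 0 (consTape 0 (consTape 1 r)))
      (some 0) blankTape (consTape 0 (onesTape (m + 5) r)) := by
    refine right rfl (right rfl ?_)
    rw [onesTape_consTape, ← onesTape_succ, ← onesTape_succ, ← onesTape_succ]
    exact hback
  have h := right (a := 0) (x := 0) rfl ((sweep_right m _ _).trans hturn)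
  rwa [show m + (m + 3 + 2 + 2) + 1 = 2 * m + 8 by ring] at h

theorem absorb_blocks (n m : ℕ) (r : ℕ → Fin 2) :
    Reaches (5 * n ^ 2 + 3 * n + 2 * m * n) (some 0) blankTape
      (consTape 0 (onesTape m (blockTape n r)))
      (some 0) blankTape (consTape 0 (onesTape (m + 5 * n) r)) := by
  induction n generalizing m with
  | zero => exact refl _ _ _
  | succ n ih =>
    rw [blockTape_succ]
    have h := (absorb_block m (blockTape n r)).trans (ih (m + 5))
    rwa [show 2 * m + 8 + (5 * n ^ 2 + 3 * n + 2 * (m + 5) * n) =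
        5 * (n + 1) ^ 2 + 3 * (n + 1) + 2 * m * (n + 1) by ring,
      show m + 5 + 5 * n = m + 5 * (n + 1) by ring] at h

theorem residue_zero (k : ℕ) :
    Reaches (5 * k ^ 2 + 19 * k + 15) (some 0) blankTape
      (consTape 0 (onesTape (3 * k) blankTape))
      (some 0) blankTape (consTape 0 (onesTape (5 * k + 6) blankTape)) := by
  have hturn : Reaches 3 (some 0) (onesTape 2 blankTape)
      (consTape 1 (blockTape k (consTape 1 blankTape)))
      (some 0) blankTape (consTape 0 (onesTape 0 (blockTape (k + 1) (consTape 1 blankTape)))) := by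
    rw [blockTape_succ]
    refine left rfl (left rfl (left_blank rfl ?_))
    exact refl _ _ _
  have h2 := make_blocks k (onesTape 2 blankTape) (consTape 1 blankTape)
  rw [onesTape, onesTape, ← Function.iterate_add_apply] at h2
  have h := (((start (3 * k)).trans h2).trans hturn).trans (absorb_blocks (k + 1) 0 _)
  rw [onesTape_consTape, ← onesTape_succ] at h
  convert h using 1
  · ring
  · congr 2
    ring

theorem residue_one (k : ℕ) :
    Reaches (5 * k ^ 2 + 25 * k + 27) (some 0) blankTape
      (consTape 0 (onesTape (3 * k + 1) blankTape))
      (some 0) blankTape (consTape 0 (onesTape (5 * k + 9) blankTape)) := by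
  have hturn : Reaches 5 (some 0) blankTape
      (consTape 1 (blockTape (k + 1) (consTape 1 blankTape)))
      (some 0) blankTape (consTape 0 (onesTape 3 (blockTape (k + 1) (consTape 1 blankTape)))) := by
    refine left_blank rfl (right rfl (left rfl (left_blank rfl (left_blank rfl ?_))))
    exact refl _ _ _
  have h := (((start (3 * k + 1)).trans
    (make_blocks (k + 1) blankTape (consTape 1 blankTape))).trans hturn).trans
    (absorb_blocks (k + 1) 3 _)
  rw [onesTape_consTape, ← onesTape_succ] at h
  convert h using 1
  · ring
  · congr 2
    ring

theorem residue_two_before_halt (k : ℕ) :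
    Reaches (6 * k + 11) (some 0) blankTape
      (consTape 0 (onesTape (3 * k + 2) blankTape))
      (some 4) blankTape
        (consTape 0 (consTape 0 (consTape 1 (blockTape (k + 1) (consTape 1 blankTape))))) := by
  have hturn : Reaches 2 (some 0) (onesTape 1 blankTape)
      (consTape 1 (blockTape (k + 1) (consTape 1 blankTape)))
      (some 4) blankTape
        (consTape 0 (consTape 0 (consTape 1 (blockTape (k + 1) (consTape 1 blankTape))))) := by
    refine left rfl (left_blank rfl ?_)
    exact refl _ _ _
  have h2 := make_blocks (k + 1) (onesTape 1 blankTape) (consTape 1 blankTape)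
  rw [onesTape, onesTape, ← Function.iterate_add_apply] at h2
  have h := ((start (3 * k + 2)).trans h2).trans hturn
  convert h using 1
  ring

end Reaches

theorem onesTape_blankTape_apply (n i : ℕ) :
    onesTape n blankTape i = if i < n then 1 else 0 := by
  induction n generalizing i with
  | zero => rfl
  | succ n ih =>
    rw [onesTape_succ]
    cases i with
    | zero => simp [consTape]
    | succ i => simp [consTape, ih]

theorem blockTape_apply (n i : ℕ) :
    blockTape n (consTape 1 blankTape) i =
      if (i < 3 * n ∧ i % 3 = 2) ∨ i = 3 * n then 1 else 0 := by
  induction n generalizing i with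
  | zero =>
    cases i with
    | zero => rfl
    | succ i => simp [blockTape, consTape, blankTape]
  | succ n ih =>
    rw [blockTape_succ]
    match i with
    | 0 => simp [consTape]
    | 1 => simp [consTape]; omega
    | 2 => simp [consTape]; omega
    | i + 3 =>
      simp only [consTape, ih]
      congr 1
      apply propext
      omega

theorem Cf_eq_zipCfg (n : ℕ) (p : ℤ) :
    Cf n p = zipCfg (some 0) p blankTape (consTape 0 (onesTape n blankTape)) := by
  simp only [Cf, zipCfg, Cfg.mk.injEq, true_and]
  funext i
  rcases lt_trichotomy i p with hi | rfl | hi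
  · rw [if_neg (by omega), if_pos hi]
    rfl
  · simp [consTape]
  · rw [if_neg (show ¬ i < p by omega), consTape_toNat _ _ _ (by omega), onesTape_blankTape_apply]
    congr 1
    apply propext
    omega

theorem zipCfg_halted (k : ℕ) (q : ℤ) :
    zipCfg none (q + 1) (consTape 1 blankTape)
        (consTape 0 (consTape 1 (blockTape (k + 1) (consTape 1 blankTape)))) =
      { state := none
        pos := q + 1
        tape := fun i =>
          if i = q ∨ i = q + 2 ∨
              (q + 5 ≤ i ∧ i ≤ q + 5 + 3 * k ∧ (i - q - 5) % 3 = 0) ∨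
              i = q + 3 * k + 6 then 1 else 0 } := by
  simp only [zipCfg, Cfg.mk.injEq, true_and]
  funext i
  rcases lt_trichotomy i q with hi | rfl | hi
  · rw [if_pos (by omega), if_neg (by omega), consTape_toNat _ _ _ (by omega)]
    rfl
  · simp [consTape]
  · rw [if_neg (by omega)]
    rcases eq_or_lt_of_le (show q + 1 ≤ i by omega) with rfl | hi
    · rw [if_neg (by omega)]
      simp [consTape]
    rw [consTape_toNat _ _ _ (by omega)]
    rcases eq_or_lt_of_le (show q + 2 ≤ i by omega) with rfl | hi
    · rw [if_pos (by omega), show q + 2 - (q + 1) - 1 = 0 by ring]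
      rfl
    rw [consTape_toNat _ _ _ (by omega), blockTape_apply]
    congr 1
    apply propext
    omega

theorem haltsIn_succ {n k : ℕ} {N : Machine n k} {c : Cfg n k} {t : ℕ}
    (hlast : ((step N)^[t] c).state ≠ none) (hhalt : ((step N)^[t + 1] c).state = none) :
    HaltsIn N c (t + 1) := by
  refine ⟨hhalt, fun i hi hnone => hlast ?_⟩
  obtain ⟨d, rfl⟩ := Nat.exists_eq_add_of_le' (Nat.lt_succ_iff.mp hi)
  have hfix : step N ((step N)^[i] c) = (step N)^[i] c := by
    simp only [step, hnone]
  rw [Function.iterate_add_apply, Function.iterate_fixed hfix, hnone]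

/-- Michel's analysis of Marxen and Buntrock's champion: for every `k`,
`C(3k) ⊢(5k²+19k+15) C(5k+6)`, `C(3k+1) ⊢(5k²+25k+27) C(5k+9)`, and from `C(3k+2)` the
machine halts in exactly `6k+12` steps with final tape `…0 1 (H0) 1 (001)^{k+1} 1 0…`. -/
theorem marxen_buntrock_champion_analysis (k : ℕ) (p : ℤ) :
    (∃ q : ℤ, (step M)^[5 * k ^ 2 + 19 * k + 15] (Cf (3 * k) p) = Cf (5 * k + 6) q) ∧
    (∃ q : ℤ, (step M)^[5 * k ^ 2 + 25 * k + 27] (Cf (3 * k + 1) p) = Cf (5 * k + 9) q) ∧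
    (HaltsIn M (Cf (3 * k + 2) p) (6 * k + 12) ∧
      ∃ q : ℤ, (step M)^[6 * k + 12] (Cf (3 * k + 2) p) =
        { state := none
          pos := q + 1
          tape := fun i =>
            if i = q ∨ i = q + 2 ∨
                (q + 5 ≤ i ∧ i ≤ q + 5 + 3 * k ∧ (i - q - 5) % 3 = 0) ∨
                i = q + 3 * k + 6 then 1 else 0 }) := by
  refine ⟨?_, ?_, ?_⟩
  · simp only [Cf_eq_zipCfg]
    exact Reaches.residue_zero k p
  · simp only [Cf_eq_zipCfg]
    exact Reaches.residue_one k p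
  · obtain ⟨q, hq⟩ := Reaches.residue_two_before_halt k p
    rw [← Cf_eq_zipCfg] at hq
    have hlast := (Function.iterate_succ_apply' (step M) (6 * k + 11) (Cf (3 * k + 2) p)).trans
      ((congrArg (step M) hq).trans (step_zipCfg_right rfl _ _ _))
    refine ⟨haltsIn_succ ?_ ?_, q, hlast.trans (zipCfg_halted k q)⟩
    · rw [hq]
      exact Option.some_ne_none _
    · rw [hlast]
      rfl
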